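/- The algebra R of the construction is a von Neumann regular ring: for every a ∈ R there exists b ∈ R with a·b·a = a. -/

import Mathlib

set_option synthInstance.maxHeartbeats 1000000
set_option maxHeartbeats 1000000

open Polynomial

namespace SkewConstruction

/-- the lower shift matrix `wₙ = ∑_{i=1}^{n-1} e_{i+1,i}` of size `n` (`w₁ = 0`). -/
def wmat (F : Type*) [Field F] (n : ℕ) : Matrix (Fin n) (Fin n) F :=
  Matrix.of fun (a b : Fin n) => if (a : ℕ) = (b : ℕ) + 1 then (1 : F) else 0

/-- `F_k = f₀ f₁ ⋯ f_k`. -/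
noncomputable def Fk {F : Type*} [Field F] (f : ℕ → F[X]) (k : ℕ) : F[X] :=
  ∏ m ∈ Finset.range (k + 1), f m

/-- `N(k)`, the degree of `F_k`. -/
noncomputable def Nk {F : Type*} [Field F] (f : ℕ → F[X]) (k : ℕ) : ℕ :=
  (Fk f k).natDegree

/-- for `n ≥ M 1`, the unique `k ≥ 1` with `M k ≤ n < M (k+1)`. -/
def kidx (M : ℕ → ℕ) (n : ℕ) : ℕ :=
  Nat.findGreatest (fun k => M k ≤ n) n

/-- the matrix `wₙ*` of the construction: for `n < M(1)` it is the upper shift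
`∑_{i=1}^{n-1} e_{i,i+1}`; for `M(k) ≤ n < M(k+1)` (`k ≥ 1`) one subtracts
`∑_{j=1}^{N(k)} a_{k,j} (e_{j,1} + e_{n,n-j+1})`, where `a_{k,j}` is the `j`-th
coefficient of `F_k` (written here via `Polynomial.coeff`, which vanishes beyond the
degree `N(k)`). -/
noncomputable def wstarmat {F : Type*} [Field F] (f : ℕ → F[X]) (M : ℕ → ℕ) (n : ℕ) :
    Matrix (Fin n) (Fin n) F :=
  (Matrix.of fun (a b : Fin n) => if (b : ℕ) = (a : ℕ) + 1 then (1 : F) else 0) -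
    (if M 1 ≤ n then
      (Matrix.of fun (a b : Fin n) =>
        (if (b : ℕ) = 0 then (Fk f (kidx M n)).coeff ((a : ℕ) + 1) else 0) +
        (if (a : ℕ) = n - 1 then (Fk f (kidx M n)).coeff (n - (b : ℕ)) else 0))
    else 0)

end SkewConstruction


namespace SkewConstruction

open Polynomial

/-- `T = ∏_{n=1}^∞ Mₙ(F)`; the index `n : ℕ` corresponds to the factor `M_{n+1}(F)`. -/
abbrev TProd (F : Type*) [Field F] : Type _ :=
  ∀ n : ℕ, Matrix (Fin (n + 1)) (Fin (n + 1)) F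

/-- the element `w = (wₙ)ₙ ∈ T`. -/
def wT (F : Type*) [Field F] : TProd F := fun n => wmat F (n + 1)

/-- the element `w* = (wₙ*)ₙ ∈ T`. -/
noncomputable def wstarT {F : Type*} [Field F] (f : ℕ → F[X]) (M : ℕ → ℕ) : TProd F :=
  fun n => wstarmat f M (n + 1)

/-- `soc(T) = ⊕_{n=1}^∞ Mₙ(F)`, the ideal of sequences with finitely many nonzero
components. -/
def socSet (F : Type*) [Field F] : Set (TProd F) :=
  {x | ∃ N : ℕ, ∀ n : ℕ, N ≤ n → x n = 0}

/-- the unital `F`-subalgebra `R` of `T` generated by `soc(T)`, `w`, `w*` and the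
inverses `f(w)⁻¹` of all `f(w)` with `f ∈ Σ` (these are units of `T`, and `Ring.inverse`
produces their inverses). -/
noncomputable def Ralg (F : Type*) [Field F] (f : ℕ → F[X]) (M : ℕ → ℕ) :
    Subalgebra F (TProd F) :=
  Algebra.adjoin F (socSet F ∪ {wT F, wstarT f M} ∪
    {y : TProd F | ∃ p : F[X], p.coeff 0 = 1 ∧ y = Ring.inverse (aeval (wT F) p)})

end SkewConstruction

/-- An element `a` of a ring is von Neumann regular if `a * b * a = a` for some `b`. -/
def IsVNRegular {A : Type*} [Ring A] (a : A) : Prop := ∃ b, a * b * a = a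

theorem IsVNRegular.of_sub {A : Type*} [Ring A] {a b : A}
    (h : IsVNRegular (a - a * b * a)) : IsVNRegular a := by
  obtain ⟨c, hc⟩ := h
  refine ⟨b + (1 - b * a) * c * (1 - a * b), ?_⟩
  calc a * (b + (1 - b * a) * c * (1 - a * b)) * a
      = a * b * a + (a - a * b * a) * c * (a - a * b * a) := by noncomm_ring
    _ = a := by rw [hc]; abel

/-- An algebra generated by two elements `w`, `s`, mutually generalized inverse, together with
the inverses of all `f(w)` with `f(0) = 1`, in which the idempotents `1 - w * s` and `1 - s * w`
are orthogonal in a strong sense. -/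
structure ShiftRelations (F : Type*) {A : Type*} [Field F] [Ring A] [Algebra F A]
    (w s : A) : Prop where
  wsw : w * s * w = w
  sws : s * w * s = s
  isUnit_aeval : ∀ f : F[X], f.coeff 0 = 1 → IsUnit (aeval w f)
  left_right : ∀ i : ℕ, (1 - w * s) * s ^ i * (1 - s * w) = 0
  right_left : ∀ (f p : F[X]) (u : A), f.coeff 0 = 1 → u * aeval w f = 1 →
    (1 - s * w) * (u * aeval w p) * (1 - w * s) = 0
  generate : ∀ B : Subalgebra F A, w ∈ B → s ∈ B →
    (∀ (f : F[X]) (u : A), f.coeff 0 = 1 → u * aeval w f = 1 → u ∈ B) → ∀ a, a ∈ B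

theorem aeval_eq_coeff_zero_add {F A : Type*} [Field F] [Ring A] [Algebra F A] (w : A)
    (p : F[X]) : aeval w p = algebraMap F A (p.coeff 0) + w * aeval w p.divX := by
  conv_lhs => rw [← p.X_mul_divX_add, map_add, map_mul, aeval_X, aeval_C, add_comm]

theorem aeval_mul_comm {F A : Type*} [Field F] [Ring A] [Algebra F A] (w : A)
    (p q : F[X]) : aeval w p * aeval w q = aeval w q * aeval w p := by
  rw [← map_mul, mul_comm, map_mul]

theorem aeval_op {F A : Type*} [Field F] [Ring A] [Algebra F A] (w : A) (p : F[X]) :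
    aeval (MulOpposite.op w) p = MulOpposite.op (aeval w p) := by
  induction p using Polynomial.induction_on' with
  | add p q hp hq => simp [hp, hq]
  | monomial n c =>
    simp only [aeval_monomial, MulOpposite.op_mul, MulOpposite.op_pow,
      MulOpposite.algebraMap_apply]
    exact (Algebra.commutes c (MulOpposite.op w ^ n))

theorem pow_add_mul_add_eq_zero {A : Type*} [Ring A] {w a b : A} {k l : ℕ}
    (ha : w ^ k * a = 0) (hb : w ^ l * b = 0) : w ^ (k + l) * (a + b) = 0 := by
  have h1 : w ^ (k + l) * a = 0 := by rw [add_comm, pow_add, mul_assoc, ha, mul_zero]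
  rw [mul_add, h1, pow_add, mul_assoc, hb, mul_zero, add_zero]

namespace ShiftRelations

variable {F A : Type*} [Field F] [Ring A] [Algebra F A] {w s : A}

theorem exists_inv (h : ShiftRelations F w s) {f : F[X]} (hf : f.coeff 0 = 1) :
    ∃ u, u * aeval w f = 1 ∧ aeval w f * u = 1 := by
  obtain ⟨u, hu⟩ := h.isUnit_aeval f hf
  exact ⟨↑u⁻¹, by simp [← hu], by simp [← hu]⟩

theorem inv_commute (h : ShiftRelations F w s) {f : F[X]} {u : A} (hf : f.coeff 0 = 1)
    (hu : u * aeval w f = 1) (p : F[X]) : u * aeval w p = aeval w p * u := by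
  obtain ⟨v, hv, hv'⟩ := h.exists_inv hf
  obtain rfl : u = v := left_inv_eq_right_inv hu hv'
  calc u * aeval w p = u * (aeval w p * aeval w f) * u := by
        rw [mul_assoc, mul_assoc (aeval w p), hv', mul_one]
    _ = aeval w p * u := by
        rw [aeval_mul_comm, ← mul_assoc, hu, one_mul]

theorem op (h : ShiftRelations F w s) :
    ShiftRelations F (MulOpposite.op w) (MulOpposite.op s) where
  wsw := by rw [← MulOpposite.op_mul, ← MulOpposite.op_mul, ← mul_assoc, h.wsw]
  sws := by rw [← MulOpposite.op_mul, ← MulOpposite.op_mul, ← mul_assoc, h.sws]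
  isUnit_aeval f hf := by
    rw [aeval_op]
    exact (h.isUnit_aeval f hf).op
  left_right i := by
    have := congrArg MulOpposite.op (h.left_right i)
    simpa [mul_assoc] using this
  right_left f p u hf hu := by
    induction u using MulOpposite.rec' with | _ u => ?_
    rw [aeval_op, ← MulOpposite.op_mul, ← MulOpposite.op_one, MulOpposite.op_inj] at hu
    obtain ⟨v, hv, hv'⟩ := h.exists_inv hf
    obtain rfl : v = u := left_inv_eq_right_inv hv hu
    have := congrArg MulOpposite.op (h.right_left f p v hf hv)
    rw [h.inv_commute hf hv] at this
    simpa [mul_assoc, aeval_op] using this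
  generate B hw hs hB a := by
    have := h.generate B.unop hw hs (fun f u hf hu => ?_) a.unop
    · simpa using this
    · refine hB f _ hf ?_
      obtain ⟨v, hv, hv'⟩ := h.exists_inv hf
      obtain rfl : u = v := left_inv_eq_right_inv hu hv'
      rw [aeval_op, ← MulOpposite.op_mul, hv', MulOpposite.op_one]

theorem mul_left_corner (h : ShiftRelations F w s) : s * (1 - w * s) = 0 := by
  rw [mul_sub, mul_one, ← mul_assoc, h.sws, sub_self]

theorem left_corner_mul (h : ShiftRelations F w s) : (1 - w * s) * w = 0 := by
  rw [sub_mul, one_mul, h.wsw, sub_self]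

theorem left_corner_mul_self (h : ShiftRelations F w s) :
    (1 - w * s) * (1 - w * s) = 1 - w * s := by
  rw [mul_sub, mul_one, ← mul_assoc, h.left_corner_mul, zero_mul, sub_zero]

/-- On the left ideal generated by `1 - w * s`, left multiplication by `s` is the backward
shift. -/
theorem mul_aeval_mul_left_corner (h : ShiftRelations F w s) (p : F[X]) :
    s * (aeval w p * (1 - w * s)) = aeval w p.divX * (1 - w * s) := by
  have h1 := h.right_left 1 p.divX 1 (by simp) (by simp)
  rw [one_mul] at h1
  rw [aeval_eq_coeff_zero_add w p, add_mul, mul_add, ← mul_assoc, ← Algebra.commutes, mul_assoc,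
    h.mul_left_corner, mul_zero, zero_add]
  rw [sub_mul, one_mul, sub_mul, sub_eq_zero] at h1
  rw [h1]
  noncomm_ring

theorem left_corner_mul_aeval (h : ShiftRelations F w s) (p : F[X]) :
    (1 - w * s) * aeval w p = algebraMap F A (p.coeff 0) * (1 - w * s) := by
  rw [aeval_eq_coeff_zero_add w p, mul_add, ← mul_assoc, h.left_corner_mul, zero_mul, add_zero,
    Algebra.commutes]

theorem left_corner_mul_pow_mul_aeval (h : ShiftRelations F w s) (i : ℕ) (p : F[X]) :
    (1 - w * s) * (s ^ i * (aeval w p * (1 - w * s))) =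
      algebraMap F A (p.coeff i) * (1 - w * s) := by
  induction i generalizing p with
  | zero =>
    rw [pow_zero, one_mul, ← mul_assoc, h.left_corner_mul_aeval, mul_assoc,
      h.left_corner_mul_self]
  | succ i ih =>
    rw [pow_succ, mul_assoc, h.mul_aeval_mul_left_corner, ih, coeff_divX]

/-- The left ideal generated by `1 - w * s` consists of the elements
`f(w)⁻¹ * p(w) * (1 - w * s)`. -/
theorem exists_aeval_mul_left_corner (h : ShiftRelations F w s) (a : A) :
    ∃ f p : F[X], f.coeff 0 = 1 ∧
      aeval w f * (a * (1 - w * s)) = aeval w p * (1 - w * s) := by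
  set e := 1 - w * s with he
  let K : A → Prop := fun x => ∃ f p : F[X], f.coeff 0 = 1 ∧ aeval w f * x = aeval w p * e
  have K_aeval : ∀ (q : F[X]) x, K x → K (aeval w q * x) := by
    rintro q x ⟨f, p, hf, hx⟩
    refine ⟨f, q * p, hf, ?_⟩
    rw [← mul_assoc, aeval_mul_comm, mul_assoc, hx, ← mul_assoc, map_mul]
  let B : Subalgebra F A :=
    { carrier := {a | ∀ x, K x → K (a * x)}
      mul_mem' := fun {a b} ha hb x hx => by
        rw [mul_assoc]
        exact ha _ (hb _ hx)
      add_mem' := fun {a b} ha hb x hx => by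
        obtain ⟨f, p, hf, h1⟩ := ha x hx
        obtain ⟨g, q, hg, h2⟩ := hb x hx
        refine ⟨f * g, g * p + f * q, by simp [mul_coeff_zero, hf, hg], ?_⟩
        have h3 : aeval w (f * g) * ((a + b) * x) =
            aeval w g * (aeval w f * (a * x)) + aeval w f * (aeval w g * (b * x)) := by
          rw [← mul_assoc (aeval w g), aeval_mul_comm w g f, map_mul]
          noncomm_ring
        rw [h3, h1, h2, map_add, map_mul, map_mul, add_mul, mul_assoc, mul_assoc]
      algebraMap_mem' := fun c x hx => by
        simpa using K_aeval (C c) x hx }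
  have key : a ∈ B := by
    refine h.generate B ?_ ?_ ?_ a
    · intro x hx
      simpa using K_aeval X x hx
    · rintro x ⟨f, p, hf, hx⟩
      obtain ⟨u, hu, hu'⟩ := h.exists_inv hf
      refine ⟨f, f * p.divX - f.divX * p, hf, ?_⟩
      have hxu : x = u * (aeval w p * e) := by rw [← hx, ← mul_assoc, hu, one_mul]
      have h1 : x = aeval w p * e - w * (aeval w f.divX * x) := by
        rw [← hx, aeval_eq_coeff_zero_add w f, hf]
        simp [add_mul, mul_assoc]
      have h2 : (1 - s * w) * (aeval w f.divX * x) = 0 := by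
        rw [hxu, ← h.right_left f (f.divX * p) u hf hu, map_mul, ← mul_assoc, ← mul_assoc,
          ← mul_assoc, ← mul_assoc, mul_assoc (1 - s * w), ← h.inv_commute hf hu]
        simp only [mul_assoc, he]
      have h3 : s * x = aeval w p.divX * e - aeval w f.divX * x := by
        conv_lhs => rw [h1]
        rw [mul_sub, h.mul_aeval_mul_left_corner, ← mul_assoc s w]
        rw [sub_mul, one_mul, sub_eq_zero] at h2
        rw [← h2]
      rw [h3, mul_sub, ← mul_assoc (aeval w f) (aeval w f.divX), aeval_mul_comm w f f.divX,
        mul_assoc (aeval w f.divX), hx, map_sub, map_mul, map_mul, sub_mul]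
      simp only [mul_assoc]
    · rintro g u hg hu x ⟨f, p, hf, hx⟩
      refine ⟨f * g, p, by simp [mul_coeff_zero, hf, hg], ?_⟩
      rw [map_mul, mul_assoc, ← mul_assoc (aeval w g), ← h.inv_commute hg hu, hu, one_mul, hx]
  exact key e ⟨1, 1, by simp, rfl⟩

theorem isVNRegular_of_mul_pow_mem (h : ShiftRelations F w s) (I : Ideal A) [I.IsTwoSided]
    (hI : ∀ x ∈ I, IsVNRegular x) (m : ℕ) (a : A) (ha : a * w ^ m ∈ I) : IsVNRegular a := by
  induction m generalizing a with
  | zero => exact hI a (by simpa using ha)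
  | succ m ih =>
    have hr : a * w ^ m * (w * s) ∈ I := by
      have := I.mul_mem_right s ha
      rwa [pow_succ, ← mul_assoc, mul_assoc] at this
    obtain ⟨f, p, hf, hp⟩ := h.exists_aeval_mul_left_corner (a * w ^ m)
    obtain ⟨u, hu, hu'⟩ := h.exists_inv hf
    have hsplit : a * w ^ m = a * w ^ m * (1 - w * s) + a * w ^ m * (w * s) := by
      noncomm_ring
    by_cases hp0 : p = 0
    · refine ih a ?_
      rw [hp0, map_zero, zero_mul] at hp
      have : a * w ^ m * (1 - w * s) = 0 := by
        rw [← one_mul (a * w ^ m * (1 - w * s)), ← congrArg (· * _) hu, mul_assoc, hp, mul_zero]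
      rw [hsplit, this, zero_add]
      exact hr
    · obtain ⟨i, hi⟩ : ∃ i, p.coeff i ≠ 0 := by
        by_contra! hc
        exact hp0 (Polynomial.ext (by simpa using hc))
      set c := algebraMap F A (p.coeff i)⁻¹ with hc
      refine IsVNRegular.of_sub (b := w ^ m * (1 - w * s) * c * s ^ i * aeval w f)
        (ih _ ?_)
      have h1 : (1 - w * s) * c * s ^ i * aeval w f * (a * w ^ m * (1 - w * s)) =
          1 - w * s := by
        rw [mul_assoc _ (aeval w f), hp, ← Algebra.commutes, mul_assoc c, mul_assoc c,
          mul_assoc (1 - w * s), h.left_corner_mul_pow_mul_aeval, ← mul_assoc, hc, ← map_mul,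
          inv_mul_cancel₀ hi, map_one, one_mul]
      have h2 : (a - a * (w ^ m * (1 - w * s) * c * s ^ i * aeval w f) * a) * w ^ m =
          a * w ^ m * (w * s) - a * w ^ m * (1 - w * s) * c * s ^ i * aeval w f *
            (a * w ^ m * (w * s)) := by
        calc _ = a * w ^ m - a * w ^ m * ((1 - w * s) * c * s ^ i * aeval w f *
                (a * w ^ m)) := by noncomm_ring
          _ = a * w ^ m - a * w ^ m * ((1 - w * s) * c * s ^ i * aeval w f *
                (a * w ^ m * (1 - w * s) + a * w ^ m * (w * s))) := by rw [← hsplit]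
          _ = _ := by rw [mul_add, h1]; noncomm_ring
      rw [h2]
      exact I.sub_mem hr (I.mul_mem_left _ hr)

/-- The two-sided ideal generated by `1 - s * w`. -/
def rightIdeal (h : ShiftRelations F w s) : Ideal A where
  carrier := {a | ∃ k, w ^ k * a = 0}
  zero_mem' := ⟨0, by simp⟩
  add_mem' := by
    rintro a b ⟨k, hk⟩ ⟨l, hl⟩
    exact ⟨k + l, pow_add_mul_add_eq_zero hk hl⟩
  smul_mem' := by
    let I : Set A := {a | ∃ k, w ^ k * a = 0}
    let B : Subalgebra F A :=
      { carrier := {a | ∀ x ∈ I, a * x ∈ I}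
        mul_mem' := fun {a b} ha hb x hx => by
          rw [mul_assoc]
          exact ha _ (hb _ hx)
        add_mem' := fun {a b} ha hb x hx => by
          obtain ⟨k, hk⟩ := ha x hx
          obtain ⟨l, hl⟩ := hb x hx
          exact ⟨k + l, add_mul a b x ▸ pow_add_mul_add_eq_zero hk hl⟩
        algebraMap_mem' := by
          rintro c x ⟨k, hk⟩
          refine ⟨k, ?_⟩
          rw [← mul_assoc, ← Algebra.commutes, mul_assoc, hk, mul_zero] }
    intro a x hx
    refine h.generate B ?_ ?_ ?_ a x hx
    · rintro x ⟨k, hk⟩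
      refine ⟨k, ?_⟩
      rw [← mul_assoc, ← pow_succ, pow_succ', mul_assoc, hk, mul_zero]
    · rintro x ⟨k, hk⟩
      refine ⟨k + 1, ?_⟩
      have hx : (1 - w * s) * x = 0 := by
        have hl : ∀ i j, (1 - w * s) * s ^ j * (w ^ i * x) = (1 - w * s) * s ^ (j + 1) *
            (w ^ (i + 1) * x) := by
          intro i j
          have := congrArg (fun z => z * (w ^ i * x)) (h.left_right j)
          simp only [zero_mul, mul_sub, sub_mul, mul_one, one_mul] at this
          rw [sub_eq_zero] at this
          rw [pow_succ, pow_succ']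
          simp only [sub_mul, one_mul, mul_assoc] at this ⊢
          exact this
        have hl' : ∀ i, (1 - w * s) * x = (1 - w * s) * s ^ i * (w ^ i * x) := by
          intro i
          induction i with
          | zero => simp
          | succ i ih => rw [ih, hl]
        rw [hl' k, hk, mul_zero]
      rw [sub_mul, one_mul, sub_eq_zero] at hx
      rw [pow_succ, mul_assoc, ← mul_assoc w s, ← hx, hk]
    · rintro f u hf hu x ⟨k, hk⟩
      refine ⟨k, ?_⟩
      have := h.inv_commute hf hu (X ^ k)
      simp only [map_pow, aeval_X] at this
      rw [← mul_assoc, ← this, mul_assoc, hk, mul_zero]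

instance (h : ShiftRelations F w s) : h.rightIdeal.IsTwoSided where
  mul_mem_of_left := by
    rintro a b ⟨k, hk⟩
    exact ⟨k, by rw [← mul_assoc, hk, zero_mul]⟩

theorem isVNRegular_of_mem_rightIdeal (h : ShiftRelations F w s) {a : A}
    (ha : a ∈ h.rightIdeal) : IsVNRegular a := by
  obtain ⟨k, hk⟩ := ha
  obtain ⟨b, hb⟩ := h.op.isVNRegular_of_mul_pow_mem ⊥
    (fun x hx => ⟨0, by rw [Ideal.mem_bot.1 hx]; simp⟩) k (MulOpposite.op a)
    (by rw [← MulOpposite.op_pow, ← MulOpposite.op_mul, hk]; simp)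
  refine ⟨b.unop, ?_⟩
  simpa [mul_assoc] using congrArg MulOpposite.unop hb

/-- The two-sided ideal generated by `1 - w * s` and `1 - s * w`. -/
def cornerIdeal (h : ShiftRelations F w s) : Ideal A where
  carrier := {a | ∃ m, a * w ^ m ∈ h.rightIdeal}
  zero_mem' := ⟨0, by simp⟩
  add_mem' := by
    rintro a b ⟨k, hk⟩ ⟨l, hl⟩
    refine ⟨k + l, ?_⟩
    have h1 := h.rightIdeal.mul_mem_right (w ^ l) hk
    have h2 := h.rightIdeal.mul_mem_right (w ^ k) hl
    rw [mul_assoc, ← pow_add] at h1 h2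
    rw [add_mul]
    exact add_mem h1 (add_comm k l ▸ h2)
  smul_mem' := by
    rintro c a ⟨k, hk⟩
    refine ⟨k, ?_⟩
    rw [smul_eq_mul, mul_assoc]
    exact h.rightIdeal.mul_mem_left _ hk

theorem isVNRegular_of_mem_cornerIdeal (h : ShiftRelations F w s) {a : A}
    (ha : a ∈ h.cornerIdeal) : IsVNRegular a := by
  obtain ⟨m, hm⟩ := ha
  exact h.isVNRegular_of_mul_pow_mem h.rightIdeal (fun _ => h.isVNRegular_of_mem_rightIdeal) m a hm

instance (h : ShiftRelations F w s) : h.cornerIdeal.IsTwoSided where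
  mul_mem_of_left := by
    let B : Subalgebra F A :=
      { carrier := {b | ∀ x ∈ h.cornerIdeal, x * b ∈ h.cornerIdeal}
        mul_mem' := fun {a b} ha hb x hx => by
          rw [← mul_assoc]
          exact hb _ (ha _ hx)
        add_mem' := fun {a b} ha hb x hx => by
          rw [mul_add]
          exact add_mem (ha x hx) (hb x hx)
        algebraMap_mem' := fun c x hx => by
          rw [← Algebra.commutes]
          exact Ideal.mul_mem_left _ _ hx }
    intro a b ha
    refine h.generate B ?_ ?_ ?_ b a ha
    · rintro x ⟨k, hk⟩
      refine ⟨k, ?_⟩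
      rw [mul_assoc, ← pow_succ', pow_succ, ← mul_assoc]
      exact Ideal.mul_mem_right _ _ hk
    · rintro x ⟨k, hk⟩
      refine ⟨k + 1, ?_⟩
      have hE : 1 - s * w ∈ h.rightIdeal :=
        ⟨1, by rw [pow_one, mul_sub, mul_one, ← mul_assoc, h.wsw, sub_self]⟩
      have : x * s * w ^ (k + 1) = x * w ^ k - x * (1 - s * w) * w ^ k := by
        rw [pow_succ']
        noncomm_ring
      rw [this]
      exact sub_mem hk (Ideal.mul_mem_right _ _ (Ideal.mul_mem_left _ _ hE))
    · rintro f u hf hu x ⟨k, hk⟩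
      refine ⟨k, ?_⟩
      have := h.inv_commute hf hu (X ^ k)
      simp only [map_pow, aeval_X] at this
      rw [mul_assoc, this, ← mul_assoc]
      exact Ideal.mul_mem_right _ _ hk

theorem one_sub_mem_cornerIdeal (h : ShiftRelations F w s) : 1 - w * s ∈ h.cornerIdeal :=
  ⟨1, by rw [pow_one, h.left_corner_mul]; exact zero_mem _⟩

theorem one_sub_pow_mul_pow_mem_cornerIdeal (h : ShiftRelations F w s) (m : ℕ) :
    1 - s ^ m * w ^ m ∈ h.cornerIdeal := by
  induction m with
  | zero => simp
  | succ m ih =>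
    have hE : 1 - s * w ∈ h.cornerIdeal := ⟨0, 1, by
      rw [pow_one, pow_zero, mul_one, mul_sub, mul_one, ← mul_assoc, h.wsw, sub_self]⟩
    have : 1 - s ^ (m + 1) * w ^ (m + 1) =
        (1 - s ^ m * w ^ m) + s ^ m * (1 - s * w) * w ^ m := by
      rw [pow_succ, pow_succ']
      noncomm_ring
    rw [this]
    exact add_mem ih (Ideal.mul_mem_right _ _ (Ideal.mul_mem_left _ _ hE))

/-- Nonzero polynomials in `w` are left invertible modulo `cornerIdeal`. -/
theorem exists_mul_aeval_sub_one_mem (h : ShiftRelations F w s) {p : F[X]} (hp : p ≠ 0) :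
    ∃ b, b * aeval w p - 1 ∈ h.cornerIdeal := by
  obtain ⟨q, hq, hq0⟩ := p.exists_eq_pow_rootMultiplicity_mul_and_not_dvd hp 0
  set m := p.rootMultiplicity 0
  rw [C_0, sub_zero] at hq hq0
  rw [X_dvd_iff] at hq0
  obtain ⟨u, hu, hu'⟩ := h.exists_inv (f := C (q.coeff 0)⁻¹ * q) (by simp [hq0])
  refine ⟨s ^ m * (u * algebraMap F A (q.coeff 0)⁻¹), ?_⟩
  have : s ^ m * (u * algebraMap F A (q.coeff 0)⁻¹) * aeval w p = s ^ m * w ^ m := by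
    rw [hq, mul_comm (X ^ m), map_mul, ← mul_assoc, mul_assoc (s ^ m),
      mul_assoc u, ← aeval_C (x := w) , ← map_mul, hu, mul_one, map_pow, aeval_X]
  rw [this, ← neg_sub]
  exact neg_mem (h.one_sub_pow_mul_pow_mem_cornerIdeal m)

/-- Modulo `cornerIdeal`, every element is a fraction of polynomials in `w`. -/
theorem exists_aeval_mul_sub_aeval_mem (h : ShiftRelations F w s) (a : A) :
    ∃ g p : F[X], g ≠ 0 ∧ aeval w g * a - aeval w p ∈ h.cornerIdeal := by
  let B : Subalgebra F A :=
    { carrier := {a | ∃ g p : F[X], g ≠ 0 ∧ aeval w g * a - aeval w p ∈ h.cornerIdeal}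
      mul_mem' := by
        rintro a b ⟨g, p, hg, h1⟩ ⟨g', p', hg', h2⟩
        refine ⟨g' * g, p * p', mul_ne_zero hg' hg, ?_⟩
        have : aeval w (g' * g) * (a * b) - aeval w (p * p') =
            aeval w g' * (aeval w g * a - aeval w p) * b +
              aeval w p * (aeval w g' * b - aeval w p') := by
          rw [map_mul, map_mul, mul_sub, mul_sub, sub_mul, aeval_mul_comm w g' p]
          noncomm_ring
        rw [this]
        exact add_mem (Ideal.mul_mem_right _ _ (Ideal.mul_mem_left _ _ h1))
          (Ideal.mul_mem_left _ _ h2)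
      add_mem' := by
        rintro a b ⟨g, p, hg, h1⟩ ⟨g', p', hg', h2⟩
        refine ⟨g' * g, g' * p + g * p', mul_ne_zero hg' hg, ?_⟩
        have : aeval w (g' * g) * (a + b) - aeval w (g' * p + g * p') =
            aeval w g' * (aeval w g * a - aeval w p) +
              aeval w g * (aeval w g' * b - aeval w p') := by
          rw [mul_add, map_mul, map_add, map_mul, map_mul, mul_sub, mul_sub,
            ← mul_assoc (aeval w g) (aeval w g'), aeval_mul_comm w g g']
          noncomm_ring
        rw [this]
        exact add_mem (Ideal.mul_mem_left _ _ h1) (Ideal.mul_mem_left _ _ h2)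
      algebraMap_mem' := fun c => ⟨1, C c, one_ne_zero, by simp⟩ }
  refine h.generate B ?_ ?_ ?_ a
  · exact ⟨1, X, one_ne_zero, by simp⟩
  · refine ⟨X, 1, X_ne_zero, ?_⟩
    rw [aeval_X, map_one, ← neg_sub]
    exact neg_mem h.one_sub_mem_cornerIdeal
  · intro f u hf hu
    refine ⟨f, 1, fun h0 => by simp [h0] at hf, ?_⟩
    rw [← h.inv_commute hf hu, hu]
    simp

theorem isVNRegular (h : ShiftRelations F w s) (a : A) : IsVNRegular a := by
  obtain ⟨g, p, hg, ha⟩ := h.exists_aeval_mul_sub_aeval_mem a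
  by_cases hp : p = 0
  · obtain ⟨b, hb⟩ := h.exists_mul_aeval_sub_one_mem hg
    refine h.isVNRegular_of_mem_cornerIdeal ?_
    rw [hp, map_zero, sub_zero] at ha
    have : a = b * (aeval w g * a) - (b * aeval w g - 1) * a := by noncomm_ring
    rw [this]
    exact sub_mem (Ideal.mul_mem_left _ _ ha) (Ideal.mul_mem_right _ _ hb)
  · obtain ⟨b, hb⟩ := h.exists_mul_aeval_sub_one_mem hp
    refine IsVNRegular.of_sub (b := b * aeval w g) (h.isVNRegular_of_mem_cornerIdeal ?_)
    have : a - a * (b * aeval w g) * a =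
        -(a * (b * (aeval w g * a - aeval w p) + (b * aeval w p - 1))) := by noncomm_ring
    rw [this]
    exact neg_mem (Ideal.mul_mem_left _ _ (add_mem (Ideal.mul_mem_left _ _ ha) hb))

end ShiftRelations

theorem Matrix.isVNRegular {F ι : Type*} [Field F] [Fintype ι] [DecidableEq ι]
    (X : Matrix ι ι F) : IsVNRegular X := by
  obtain ⟨g, hg⟩ := (Matrix.toLin' X).rangeRestrict.exists_rightInverse_of_surjective
    (LinearMap.range_rangeRestrict _)
  obtain ⟨k, hk⟩ := g.exists_extend
  refine ⟨LinearMap.toMatrix' k, Matrix.toLin'.injective (LinearMap.ext fun v => ?_)⟩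
  rw [Matrix.toLin'_mul, Matrix.toLin'_mul, Matrix.toLin'_toMatrix', LinearMap.comp_apply,
    LinearMap.comp_apply]
  have h1 := LinearMap.congr_fun hk ((Matrix.toLin' X).rangeRestrict v)
  have h2 := congrArg Subtype.val (LinearMap.congr_fun hg ((Matrix.toLin' X).rangeRestrict v))
  simp only [LinearMap.comp_apply, Submodule.subtype_apply, LinearMap.codRestrict_apply,
    LinearMap.rangeRestrict, LinearMap.id_apply] at h1 h2
  rw [h1, h2]

namespace SkewConstruction

variable {F : Type*} [Field F] {n : ℕ}

theorem wmat_mul_zero (X : Matrix (Fin (n + 1)) (Fin (n + 1)) F) (b : Fin (n + 1)) :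
    (wmat F (n + 1) * X) 0 b = 0 := by
  simp [Matrix.mul_apply, wmat]

theorem wmat_mul_succ (X : Matrix (Fin (n + 1)) (Fin (n + 1)) F) (a : Fin n) (b : Fin (n + 1)) :
    (wmat F (n + 1) * X) a.succ b = X a.castSucc b := by
  rw [Matrix.mul_apply, Finset.sum_eq_single a.castSucc]
  · simp [wmat]
  · intro c _ hc
    have : (a : ℕ) ≠ c := fun h => hc (Fin.ext h.symm)
    simp [wmat, this]
  · simp

theorem mul_wmat_last (X : Matrix (Fin (n + 1)) (Fin (n + 1)) F) (a : Fin (n + 1)) :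
    (X * wmat F (n + 1)) a (Fin.last n) = 0 := by
  rw [Matrix.mul_apply]
  refine Finset.sum_eq_zero fun c _ => ?_
  have : (c : ℕ) ≠ n + 1 := by omega
  simp [wmat, this]

theorem mul_wmat_castSucc (X : Matrix (Fin (n + 1)) (Fin (n + 1)) F) (a : Fin (n + 1))
    (b : Fin n) : (X * wmat F (n + 1)) a b.castSucc = X a b.succ := by
  rw [Matrix.mul_apply, Finset.sum_eq_single b.succ]
  · simp [wmat]
  · intro c _ hc
    have : (c : ℕ) ≠ b + 1 := fun h => hc (Fin.ext h)
    simp [wmat, this]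
  · simp

theorem wmat_pow_apply (j : ℕ) (a b : Fin (n + 1)) :
    (wmat F (n + 1) ^ j) a b = if (a : ℕ) = b + j then 1 else 0 := by
  induction j generalizing a with
  | zero => simp [Matrix.one_apply, Fin.ext_iff]
  | succ j ih =>
    rw [pow_succ']
    cases a using Fin.cases with
    | zero => rw [wmat_mul_zero]; simp
    | succ a => rw [wmat_mul_succ, ih]; simp [← add_assoc]

theorem aeval_wmat_apply (q : F[X]) (a b : Fin (n + 1)) :
    (aeval (wmat F (n + 1)) q) a b = if (b : ℕ) ≤ a then q.coeff (a - b) else 0 := by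
  induction q using Polynomial.induction_on' with
  | add p q hp hq =>
    rw [map_add, Matrix.add_apply, hp, hq]
    split_ifs <;> simp
  | monomial k c =>
    rw [aeval_monomial, ← Algebra.smul_def, Matrix.smul_apply, wmat_pow_apply, coeff_monomial]
    split_ifs <;> first | omega | simp

theorem isUnit_aeval_wmat {p : F[X]} (hp : p.coeff 0 = 1) :
    IsUnit (aeval (wmat F (n + 1)) p) := by
  rw [aeval_eq_coeff_zero_add, hp, map_one]
  refine IsNilpotent.isUnit_one_add (Commute.isNilpotent_mul_right ?_ ⟨n + 1, ?_⟩)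
  · simpa [Commute, SemiconjBy] using aeval_mul_comm (wmat F (n + 1)) X p.divX
  · ext a b
    rw [wmat_pow_apply, if_neg (by omega), Matrix.zero_apply]

theorem single_last_mul_aeval_mul_single_zero {q : F[X]} (hq : q.natDegree < n) :
    Matrix.single (Fin.last n) (Fin.last n) 1 * aeval (wmat F (n + 1)) q *
      Matrix.single 0 0 1 = 0 := by
  rw [Matrix.single_mul_mul_single, aeval_wmat_apply]
  simp [coeff_eq_zero_of_natDegree_lt hq]

/-- `S` is the upper shift matrix of size `n + 1`, modified by the coefficients of `K` in the
first column and in the last row. -/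
def IsModifiedShift (K : F[X]) (S : Matrix (Fin (n + 1)) (Fin (n + 1)) F) : Prop :=
  ∀ a b : Fin (n + 1), S a b = (if (b : ℕ) = a + 1 then 1 else 0) -
    ((if (b : ℕ) = 0 then K.coeff (a + 1) else 0) +
      (if (a : ℕ) = n then K.coeff (n + 1 - b) else 0))

namespace IsModifiedShift

variable {K : F[X]} {S : Matrix (Fin (n + 1)) (Fin (n + 1)) F}

theorem one_sub_wmat_mul (hS : IsModifiedShift K S) (hK : K.coeff 0 = 1) :
    1 - wmat F (n + 1) * S = aeval (wmat F (n + 1)) K * Matrix.single 0 0 1 := by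
  have key : ∀ a b : Fin (n + 1),
      (aeval (wmat F (n + 1)) K * Matrix.single 0 0 1 : Matrix _ _ F) a b =
      if b = 0 then K.coeff a else 0 := by
    intro a b
    by_cases hb : b = 0
    · simp [hb, aeval_wmat_apply]
    · simp [hb]
  ext a b
  rw [key, Matrix.sub_apply, Matrix.one_apply]
  cases a using Fin.cases with
  | zero =>
    rw [wmat_mul_zero]
    simp [hK, eq_comm]
  | succ a =>
    rw [wmat_mul_succ, hS]
    have h1 : (a : ℕ) ≠ n := by omega
    simp only [Fin.ext_iff, Fin.val_succ, Fin.val_castSucc, Fin.val_zero, h1, if_false, add_zero]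
    split_ifs <;> first | omega | simp

theorem one_sub_mul_wmat (hS : IsModifiedShift K S) (hK : K.coeff 0 = 1) :
    1 - S * wmat F (n + 1) =
      Matrix.single (Fin.last n) (Fin.last n) 1 * aeval (wmat F (n + 1)) K := by
  have key : ∀ a b : Fin (n + 1),
      (Matrix.single (Fin.last n) (Fin.last n) 1 * aeval (wmat F (n + 1)) K : Matrix _ _ F) a b =
      if a = Fin.last n then K.coeff (n - b) else 0 := by
    intro a b
    by_cases ha : a = Fin.last n
    · simp [ha, aeval_wmat_apply, Fin.is_le]
    · simp [ha]
  ext a b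
  rw [key, Matrix.sub_apply, Matrix.one_apply]
  cases b using Fin.lastCases with
  | last =>
    rw [mul_wmat_last]
    simp [hK]
  | cast b =>
    rw [mul_wmat_castSucc, hS]
    simp only [Fin.ext_iff, Fin.val_succ, Fin.val_castSucc, Fin.val_last, Nat.succ_ne_zero,
      if_false, zero_add, Nat.add_sub_add_right]
    split_ifs <;> first | omega | simp

theorem one_sub_wmat_mul_mul_wmat (hS : IsModifiedShift K S) (hK : K.coeff 0 = 1) :
    (1 - wmat F (n + 1) * S) * wmat F (n + 1) = 0 := by
  rw [hS.one_sub_wmat_mul hK, mul_assoc]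
  convert mul_zero _
  ext a b
  by_cases ha : a = 0
  · simp [ha, wmat]
  · simp [ha]

theorem mul_one_sub_wmat_mul (hS : IsModifiedShift K S) (hK : K.coeff 0 = 1)
    (hn : 2 * K.natDegree < n) : S * (1 - wmat F (n + 1) * S) = 0 := by
  rw [hS.one_sub_wmat_mul hK, ← mul_assoc]
  ext a b
  by_cases hb : b = 0
  swap
  · simp [hb]
  have hK0 : ∀ m, K.natDegree < m → K.coeff m = 0 := fun m => coeff_eq_zero_of_natDegree_lt
  have hlast : ∀ c : Fin (n + 1), (if (a : ℕ) = n then K.coeff (n + 1 - c) else 0) *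
      K.coeff c = 0 := by
    intro c
    split_ifs
    · by_cases hc : K.natDegree < c
      · rw [hK0 c hc, mul_zero]
      · rw [hK0 (n + 1 - c) (by omega), zero_mul]
    · rw [zero_mul]
  have hfirst : ∑ c : Fin (n + 1), (if (c : ℕ) = 0 then K.coeff (a + 1) else 0) * K.coeff c =
      K.coeff (a + 1) := by
    rw [Finset.sum_eq_single 0]
    · simp [hK]
    · intro c _ hc
      rw [if_neg (show ¬(c : ℕ) = 0 from fun h => hc (Fin.ext h)), zero_mul]
    · simp
  have hshift : ∑ c : Fin (n + 1), (if (c : ℕ) = a + 1 then 1 else 0) * K.coeff c =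
      K.coeff (a + 1) := by
    by_cases ha : (a : ℕ) = n
    · rw [hK0 _ (by omega)]
      refine Finset.sum_eq_zero fun c _ => ?_
      rw [if_neg (by omega), zero_mul]
    · rw [Finset.sum_eq_single ⟨a + 1, by omega⟩]
      · simp
      · intro c _ hc
        rw [if_neg (fun h => hc (Fin.ext h)), zero_mul]
      · simp
  rw [hb, Matrix.mul_single_apply_same, mul_one, Matrix.mul_apply, Matrix.zero_apply]
  simp only [hS a, aeval_wmat_apply, Fin.val_zero, Nat.zero_le, if_true, Nat.sub_zero, sub_mul,
    add_mul, hlast, add_zero, Finset.sum_sub_distrib, hfirst, hshift, sub_self]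

theorem pow_apply_zero (hS : IsModifiedShift K S) (i : ℕ) (hi : i ≤ n) (b : Fin (n + 1))
    (hb : i < b) : (S ^ i) 0 b = 0 := by
  induction i generalizing b with
  | zero =>
    rw [pow_zero, Matrix.one_apply_ne]
    rintro rfl
    simp at hb
  | succ i ih =>
    rw [pow_succ, Matrix.mul_apply]
    refine Finset.sum_eq_zero fun a _ => ?_
    by_cases ha : i < a
    · rw [ih (by omega) a ha, zero_mul]
    · rw [hS, if_neg (by omega), if_neg (by omega), if_neg (by omega)]
      simp

theorem left_right (hS : IsModifiedShift K S) (hK : K.coeff 0 = 1) {i : ℕ} (hi : i < n) :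
    (1 - wmat F (n + 1) * S) * S ^ i * (1 - S * wmat F (n + 1)) = 0 := by
  have : Matrix.single 0 0 1 * S ^ i * Matrix.single (Fin.last n) (Fin.last n) 1 = 0 := by
    rw [Matrix.single_mul_mul_single, hS.pow_apply_zero i hi.le _ (by simpa using hi)]
    simp
  rw [hS.one_sub_wmat_mul hK, hS.one_sub_mul_wmat hK, mul_assoc, mul_assoc, ← mul_assoc (S ^ i),
    ← mul_assoc (Matrix.single 0 0 1), ← mul_assoc (Matrix.single 0 0 1), this]
  simp

theorem right_left (hS : IsModifiedShift K S) (hK : K.coeff 0 = 1) {f p : F[X]} (hf : f ∣ K)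
    (hn : 2 * K.natDegree + p.natDegree < n) {u : Matrix (Fin (n + 1)) (Fin (n + 1)) F}
    (hu : u * aeval (wmat F (n + 1)) f = 1) :
    (1 - S * wmat F (n + 1)) * (u * aeval (wmat F (n + 1)) p) * (1 - wmat F (n + 1) * S) = 0 := by
  have hK0 : K ≠ 0 := by
    rintro rfl
    simp at hK
  obtain ⟨q, hq⟩ := hf
  have hqK : q.natDegree ≤ K.natDegree := natDegree_le_of_dvd ⟨f, by rw [hq, mul_comm]⟩ hK0
  have hKu : aeval (wmat F (n + 1)) K * u = aeval (wmat F (n + 1)) q := by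
    rw [hq, mul_comm, map_mul, mul_assoc, mul_eq_one_comm.1 hu, mul_one]
  have hdeg : (q * p * K).natDegree < n := by
    have h1 := natDegree_mul_le (p := q * p) (q := K)
    have h2 := natDegree_mul_le (p := q) (q := p)
    omega
  rw [hS.one_sub_wmat_mul hK, hS.one_sub_mul_wmat hK,
    ← single_last_mul_aeval_mul_single_zero hdeg, map_mul, map_mul, ← hKu]
  simp only [mul_assoc]

end IsModifiedShift

theorem isModifiedShift_wstarmat (f : ℕ → F[X]) (M : ℕ → ℕ) (h : M 1 ≤ n + 1) :
    IsModifiedShift (Fk f (kidx M (n + 1))) (wstarmat f M (n + 1)) := by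
  intro a b
  simp [wstarmat, h]

theorem Fk_coeff_zero {f : ℕ → F[X]} (hf : ∀ m, (f m).coeff 0 = 1) (k : ℕ) :
    (Fk f k).coeff 0 = 1 := by
  simp only [coeff_zero_eq_eval_zero] at hf ⊢
  simp [Fk, eval_prod, hf]

theorem le_kidx {M : ℕ → ℕ} (hM : StrictMono M) {k n : ℕ} (h : M k ≤ n) : k ≤ kidx M n :=
  Nat.le_findGreatest (hM.le_apply.trans h) h

theorem dvd_Fk (f : ℕ → F[X]) {m k : ℕ} (h : m ≤ k) : f m ∣ Fk f k :=
  Finset.dvd_prod_of_mem f (by simpa using Nat.lt_succ_of_le h)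

theorem exists_forall_natDegree_Fk_lt (f : ℕ → F[X]) {M : ℕ → ℕ} (hM : StrictMono M)
    (hMN : ∀ k : ℕ, 1 ≤ k → 2 * (k + 1) * Nk f k ≤ M k) (d m : ℕ) :
    ∃ N, ∀ n, N ≤ n → M 1 ≤ n + 1 ∧ m ≤ kidx M (n + 1) ∧
      2 * (Fk f (kidx M (n + 1))).natDegree + d < n := by
  refine ⟨M 1 + M m + M (d + 2) + d + 1, fun n hn => ?_⟩
  have hk := le_kidx hM (show M (d + 2) ≤ n + 1 by omega)
  refine ⟨by omega, le_kidx hM (by omega), ?_⟩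
  have hk' : M (kidx M (n + 1)) ≤ n + 1 :=
    Nat.findGreatest_spec (P := fun k => M k ≤ n + 1) (m := 1) (by omega) (by omega)
  generalize kidx M (n + 1) = k at hk hk'
  have h1 := hMN k (by omega)
  rw [Nk] at h1
  generalize (Fk f k).natDegree = D at h1
  rcases Nat.eq_zero_or_pos D with rfl | hD
  · omega
  · nlinarith

end SkewConstruction

namespace SkewConstruction

variable {F : Type*} [Field F] {f : ℕ → F[X]} {M : ℕ → ℕ}

theorem isUnit_aeval_wT {p : F[X]} (hp : p.coeff 0 = 1) : IsUnit (aeval (wT F) p) := by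
  rw [Pi.isUnit_iff]
  intro n
  have := aeval_algHom_apply (Pi.evalAlgHom F (fun n => Matrix (Fin (n + 1)) (Fin (n + 1)) F) n)
    (wT F) p
  rw [Pi.evalAlgHom_apply, Pi.evalAlgHom_apply] at this
  rw [← this]
  exact isUnit_aeval_wmat hp

theorem mem_Ralg_of_mem_socSet {x : TProd F} (hx : x ∈ socSet F) : x ∈ Ralg F f M :=
  Algebra.subset_adjoin (Or.inl (Or.inl hx))

theorem inverse_mem_Ralg {p : F[X]} (hp : p.coeff 0 = 1) :
    Ring.inverse (aeval (wT F) p) ∈ Ralg F f M :=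
  Algebra.subset_adjoin (Or.inr ⟨p, hp, rfl⟩)

variable (F f M) in
/-- `w` as an element of `Ralg F f M`. -/
def wR : Ralg F f M := ⟨wT F, Algebra.subset_adjoin (by simp)⟩

variable (F f M) in
/-- `w*` as an element of `Ralg F f M`. -/
noncomputable def wstarR : Ralg F f M := ⟨wstarT f M, Algebra.subset_adjoin (by simp)⟩

variable (F f M) in
/-- The ideal `soc(T)` of `Ralg F f M`. -/
def socR : Ideal (Ralg F f M) where
  carrier := {x | x.1 ∈ socSet F}
  zero_mem' := ⟨0, fun _ _ => rfl⟩
  add_mem' := by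
    rintro x y ⟨k, hk⟩ ⟨l, hl⟩
    refine ⟨k + l, fun n hn => ?_⟩
    have h1 := hk n (by omega)
    have h2 := hl n (by omega)
    simp [h1, h2]
  smul_mem' := by
    rintro c x ⟨k, hk⟩
    refine ⟨k, fun n hn => ?_⟩
    have h1 := hk n hn
    simp [h1]

instance : (socR F f M).IsTwoSided where
  mul_mem_of_left := by
    rintro x c ⟨k, hk⟩
    refine ⟨k, fun n hn => ?_⟩
    have h1 := hk n hn
    simp [h1]

variable (F f M) in
/-- The projection of `Ralg F f M` onto the matrices of size `n + 1`. -/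
noncomputable def evalR (n : ℕ) : Ralg F f M →ₐ[F] Matrix (Fin (n + 1)) (Fin (n + 1)) F :=
  (Pi.evalAlgHom F (fun n => Matrix (Fin (n + 1)) (Fin (n + 1)) F) n).comp (Ralg F f M).val

theorem evalR_wR (n : ℕ) : evalR F f M n (wR F f M) = wmat F (n + 1) := rfl

theorem evalR_wstarR (n : ℕ) : evalR F f M n (wstarR F f M) = wstarmat f M (n + 1) := rfl

theorem evalR_aeval_wR (n : ℕ) (p : F[X]) :
    evalR F f M n (aeval (wR F f M) p) = aeval (wmat F (n + 1)) p := by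
  rw [← aeval_algHom_apply, evalR_wR]

variable (F f M) in
/-- The quotient map of `Ralg F f M` by its ideal `soc(T)`. -/
noncomputable def mkSoc : Ralg F f M →ₐ[F] Ralg F f M ⧸ socR F f M :=
  Ideal.Quotient.mkₐ F (socR F f M)

theorem mkSoc_surjective : Function.Surjective (mkSoc F f M) :=
  Ideal.Quotient.mkₐ_surjective F _

theorem mkSoc_eq_zero_iff {x : Ralg F f M} :
    mkSoc F f M x = 0 ↔ ∃ N, ∀ n, N ≤ n → evalR F f M n x = 0 :=
  Ideal.Quotient.eq_zero_iff_mem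

theorem mkSoc_eq_iff {x y : Ralg F f M} :
    mkSoc F f M x = mkSoc F f M y ↔ ∃ N, ∀ n, N ≤ n → evalR F f M n x = evalR F f M n y := by
  rw [← sub_eq_zero, ← map_sub, mkSoc_eq_zero_iff]
  simp only [map_sub, sub_eq_zero]

theorem inverse_mul_aeval_wR {p : F[X]} (hp : p.coeff 0 = 1) :
    (⟨_, inverse_mem_Ralg hp⟩ : Ralg F f M) * aeval (wR F f M) p = 1 ∧
      aeval (wR F f M) p * (⟨_, inverse_mem_Ralg hp⟩ : Ralg F f M) = 1 := by
  have h : (aeval (wR F f M) p : Ralg F f M).1 = aeval (wT F) p :=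
    (aeval_algHom_apply (Ralg F f M).val (wR F f M) p).symm
  constructor <;> apply Subtype.ext
  · simpa [h] using Ring.inverse_mul_cancel _ (isUnit_aeval_wT hp)
  · simpa [h] using Ring.mul_inverse_cancel _ (isUnit_aeval_wT hp)

theorem shiftRelations (hfmem : ∀ m : ℕ, (f m).coeff 0 = 1)
    (hfenum : ∀ p : F[X], p.coeff 0 = 1 → ∃ m : ℕ, f m = p) (hM : StrictMono M)
    (hMN : ∀ k : ℕ, 1 ≤ k → 2 * (k + 1) * Nk f k ≤ M k) :
    ShiftRelations F (mkSoc F f M (wR F f M)) (mkSoc F f M (wstarR F f M)) where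
  wsw := by
    rw [← map_mul, ← map_mul, mkSoc_eq_iff]
    obtain ⟨N, hN⟩ := exists_forall_natDegree_Fk_lt f hM hMN 0 0
    refine ⟨N, fun n hn => ?_⟩
    have := (isModifiedShift_wstarmat f M (hN n hn).1).one_sub_wmat_mul_mul_wmat
      (Fk_coeff_zero hfmem _)
    rw [sub_mul, one_mul, sub_eq_zero] at this
    rw [map_mul, map_mul, evalR_wR, evalR_wstarR, ← this]
  sws := by
    rw [← map_mul, ← map_mul, mkSoc_eq_iff]
    obtain ⟨N, hN⟩ := exists_forall_natDegree_Fk_lt f hM hMN 0 0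
    refine ⟨N, fun n hn => ?_⟩
    have := (isModifiedShift_wstarmat f M (hN n hn).1).mul_one_sub_wmat_mul
      (Fk_coeff_zero hfmem _) (hN n hn).2.2
    rw [mul_sub, mul_one, sub_eq_zero, ← mul_assoc] at this
    rw [map_mul, map_mul, evalR_wR, evalR_wstarR, ← this]
  isUnit_aeval p hp := by
    obtain ⟨h1, h2⟩ := inverse_mul_aeval_wR (f := f) (M := M) hp
    rw [aeval_algHom_apply]
    exact (isUnit_iff_exists.2 ⟨_, h2, h1⟩).map _
  left_right i := by
    rw [← map_one (mkSoc F f M), ← map_mul, ← map_mul, ← map_sub, ← map_sub, ← map_pow,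
      ← map_mul, ← map_mul, mkSoc_eq_zero_iff]
    obtain ⟨N, hN⟩ := exists_forall_natDegree_Fk_lt f hM hMN i 0
    refine ⟨N, fun n hn => ?_⟩
    have := (isModifiedShift_wstarmat f M (hN n hn).1).left_right (i := i)
      (Fk_coeff_zero hfmem _) (by have := (hN n hn).2.2; omega)
    simpa only [map_mul, map_sub, map_one, map_pow, evalR_wR, evalR_wstarR] using this
  right_left g p u hg hu := by
    obtain ⟨u, rfl⟩ := mkSoc_surjective u
    obtain ⟨m, rfl⟩ := hfenum g hg
    rw [aeval_algHom_apply] at hu ⊢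
    rw [← map_one (mkSoc F f M), ← map_mul, mkSoc_eq_iff] at hu
    rw [← map_one (mkSoc F f M), ← map_mul, ← map_mul, ← map_mul, ← map_sub,
      ← map_sub, ← map_mul, ← map_mul, mkSoc_eq_zero_iff]
    obtain ⟨N', hu⟩ := hu
    obtain ⟨N, hN⟩ := exists_forall_natDegree_Fk_lt f hM hMN p.natDegree m
    refine ⟨N + N', fun n hn => ?_⟩
    obtain ⟨hn1, hn2, hn3⟩ := hN n (by omega)
    have hun := hu n (by omega)
    rw [map_mul, evalR_aeval_wR, map_one] at hun
    have := (isModifiedShift_wstarmat f M hn1).right_left (Fk_coeff_zero hfmem _)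
      (dvd_Fk f hn2) hn3 hun
    simpa only [map_mul, map_sub, map_one, evalR_aeval_wR, evalR_wR, evalR_wstarR] using this
  generate B hw hs hB a := by
    obtain ⟨⟨x, hx⟩, rfl⟩ := mkSoc_surjective a
    refine Algebra.adjoin_induction (p := fun x hx => mkSoc F f M ⟨x, hx⟩ ∈ B) ?_ ?_ ?_ ?_ hx
    · rintro x ((hx | rfl | rfl) | ⟨p, hp, rfl⟩)
      · have : mkSoc F f M ⟨x, mem_Ralg_of_mem_socSet hx⟩ = 0 := mkSoc_eq_zero_iff.2 hx
        exact this ▸ zero_mem B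
      · exact hw
      · exact hs
      · refine hB p _ hp ?_
        rw [aeval_algHom_apply, ← map_mul, (inverse_mul_aeval_wR hp).1, map_one]
    · intro c
      have : mkSoc F f M (algebraMap F _ c) ∈ B := by
        rw [AlgHom.commutes]
        exact B.algebraMap_mem c
      exact this
    · intro x y hx hy h1 h2
      have := add_mem h1 h2
      rwa [← map_add] at this
    · intro x y hx hy h1 h2
      have := mul_mem h1 h2
      rwa [← map_mul] at this

theorem isVNRegular_of_mkSoc_eq_zero {x : Ralg F f M} (hx : mkSoc F f M x = 0) :
    IsVNRegular x := by
  obtain ⟨N, hN⟩ := mkSoc_eq_zero_iff.1 hx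
  choose b hb using fun n => (x.1 n).isVNRegular
  have hsoc : (fun n => if n < N then b n else 0 : TProd F) ∈ socSet F :=
    ⟨N, fun n hn => if_neg (not_lt.2 hn)⟩
  refine ⟨⟨_, mem_Ralg_of_mem_socSet hsoc⟩, Subtype.ext (funext fun n => ?_)⟩
  change x.1 n * (if n < N then b n else 0) * x.1 n = x.1 n
  split_ifs with h
  · exact hb n
  · have : x.1 n = 0 := hN n (not_lt.1 h)
    simp [this]

end SkewConstruction

open SkewConstruction in
/-- Theorem 5.8 of the paper (first part): the algebra `R` of the construction is
von Neumann regular. -/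
theorem stmt8 {F : Type*} [Field F] [Countable F]
    (f : ℕ → F[X]) (hf0 : f 0 = 1)
    (hfmem : ∀ m : ℕ, (f m).coeff 0 = 1)
    (hfenum : ∀ p : F[X], p.coeff 0 = 1 → ∃ m : ℕ, f m = p)
    (M : ℕ → ℕ) (hM : StrictMono M) (hM1 : 1 ≤ M 1)
    (hMN : ∀ k : ℕ, 1 ≤ k → 2 * (k + 1) * Nk f k ≤ M k) :
    ∀ a ∈ Ralg F f M, ∃ b ∈ Ralg F f M, a * b * a = a := by
  intro a ha
  suffices h : IsVNRegular (⟨a, ha⟩ : Ralg F f M) by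
    obtain ⟨b, hb⟩ := h
    exact ⟨b.1, b.2, congrArg Subtype.val hb⟩
  obtain ⟨b, hb⟩ := (shiftRelations hfmem hfenum hM hMN).isVNRegular (mkSoc F f M ⟨a, ha⟩)
  obtain ⟨b, rfl⟩ := mkSoc_surjective b
  refine IsVNRegular.of_sub (b := b) (isVNRegular_of_mkSoc_eq_zero ?_)
  rw [map_sub, map_mul, map_mul, hb, sub_self]
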